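/- arXiv:1802.07830 — 2 statements merged into one kernel-verified Lean document; each statement's English description precedes it below -/
import Mathlib

section
/- Let Z be a finite-dimensional vector space over ℝ, let m ∈ ℕ, and let φ : Z →ₗ[ℝ] (Fin m → ℝ) be an ℝ-linear map. Then there exists a finite set S ⊆ Z such that φ⁻¹({y | ∀ i, 0 ≤ y i}) is exactly the set of all finite linear combinations ∑_{s ∈ S} t s • s with coefficients t s ∈ ℝ, t s ≥ 0. In other words, the preimage of the nonnegative orthant is a finitely generated convex cone. -/
namespace PointedCone

section Field

variable {𝕜 E : Type*} [Field 𝕜] [LinearOrder 𝕜] [IsStrictOrderedRing 𝕜]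
  [AddCommGroup E] [Module 𝕜 E]

/-- A linearly ordered field is generated, as a cone over its nonnegative elements, by `1` and
`-1`. -/
theorem finite_nonneg_self : Module.Finite {c : 𝕜 // 0 ≤ c} 𝕜 := by
  classical
  refine ⟨⟨{1, -1}, eq_top_iff.2 fun x _ => ?_⟩⟩
  have h_one : (1 : 𝕜) ∈ hull 𝕜 (({1, -1} : Finset 𝕜) : Set 𝕜) := subset_hull (by simp)
  have h_neg : (-1 : 𝕜) ∈ hull 𝕜 (({1, -1} : Finset 𝕜) : Set 𝕜) := subset_hull (by simp)
  rcases le_total 0 x with hx | hx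
  · simpa using PointedCone.smul_mem _ hx h_one
  · simpa using PointedCone.smul_mem _ (neg_nonneg.2 hx) h_neg

/-- A finite-dimensional vector space is finitely generated as a cone. -/
theorem fg_top [FiniteDimensional 𝕜 E] : (⊤ : PointedCone 𝕜 E).FG :=
  have := finite_nonneg_self (𝕜 := 𝕜)
  (Module.Finite.fg_top (R := 𝕜) (M := E)).restrictScalars

theorem nonneg_of_mem_hull {s : Set E} {f : E →ₗ[𝕜] 𝕜} (hs : ∀ x ∈ s, 0 ≤ f x) {x : E}
    (hx : x ∈ hull 𝕜 s) : 0 ≤ f x := by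
  have h : hull 𝕜 s ≤ (positive 𝕜 𝕜).comap f :=
    Submodule.span_le.2 fun y hy => by simpa using hs y hy
  simpa using h hx

theorem eq_zero_of_mem_hull {s : Set E} {f : E →ₗ[𝕜] 𝕜} (hs : ∀ x ∈ s, f x < 0) {x : E}
    (hx : x ∈ hull 𝕜 s) (hfx : 0 ≤ f x) : x = 0 := by
  have h : f x ≤ 0 ∧ (f x = 0 → x = 0) := by
    clear hfx
    induction hx using Submodule.span_induction with
    | mem x hx => exact ⟨(hs x hx).le, fun h => absurd h (hs x hx).ne⟩
    | zero => simp
    | add x y _ _ ihx ihy =>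
      rw [map_add]
      refine ⟨add_nonpos ihx.1 ihy.1, fun h => ?_⟩
      rw [ihx.2 (by linarith [ihx.1, ihy.1]), ihy.2 (by linarith [ihx.1, ihy.1]), add_zero]
    | smul c x _ ih =>
      have h_map : f (c • x) = c * f x := f.map_smul (c : 𝕜) x
      rw [h_map]
      refine ⟨mul_nonpos_of_nonneg_of_nonpos c.2 ih.1, fun h => ?_⟩
      rcases mul_eq_zero.1 h with hc | hx
      · rw [show c = 0 from Subtype.ext hc, zero_smul]
      · rw [ih.2 hx, smul_zero]
  exact h.2 (le_antisymm h.1 hfx)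

/-- Eliminating a linear functional is bilinear in the two vectors that are combined, so it maps
a pair of cones into any cone containing the combinations of the generators. -/
theorem smul_sub_smul_mem_of_mem_hull {s t : Set E} {f : E →ₗ[𝕜] 𝕜} {D : PointedCone 𝕜 E}
    (h : ∀ x ∈ s, ∀ y ∈ t, f x • y - f y • x ∈ D) {x y : E}
    (hx : x ∈ hull 𝕜 s) (hy : y ∈ hull 𝕜 t) : f x • y - f y • x ∈ D := by
  have h_left : ∀ z ∈ t, s ⊆ D.comap (f.smulRight z - f z • LinearMap.id) :=
    fun z hz w hw => by simpa using h w hw z hz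
  have h_right : t ⊆ D.comap (f x • LinearMap.id - f.smulRight x) := fun z hz => by
    simpa using Submodule.span_le.2 (h_left z hz) hx
  simpa using Submodule.span_le.2 h_right hy

/-- Intersecting a finitely generated cone with a closed half-space yields a finitely generated
cone. -/
theorem fg_inf_comap_positive {C : PointedCone 𝕜 E} (hC : C.FG) (f : E →ₗ[𝕜] 𝕜) :
    (C ⊓ (positive 𝕜 𝕜).comap f).FG := by
  obtain ⟨S, hS, rfl⟩ := Submodule.fg_def.1 hC
  set P : Set E := {x ∈ S | 0 ≤ f x} with hP
  set N : Set E := {x ∈ S | f x < 0} with hN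
  set G : Set E := P ∪ Set.image2 (fun x y => f x • y - f y • x) P N
  have hP_fin : P.Finite := hS.subset (Set.sep_subset _ _)
  have hN_fin : N.Finite := hS.subset (Set.sep_subset _ _)
  refine Submodule.fg_def.2 ⟨G, hP_fin.union (hP_fin.image2 _ hN_fin), le_antisymm ?_ ?_⟩
  · refine Submodule.span_le.2 ?_
    rintro _ (⟨hx, hfx⟩ | ⟨x, ⟨hx, hfx⟩, y, ⟨hy, hfy⟩, rfl⟩)
    · exact ⟨subset_hull hx, by simpa using hfx⟩
    · refine ⟨?_, ?_⟩
      · have := add_mem (PointedCone.smul_mem _ hfx (subset_hull (R := 𝕜) hy))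
          (PointedCone.smul_mem _ (neg_nonneg.2 hfy.le) (subset_hull (R := 𝕜) hx))
        simpa [sub_eq_add_neg] using this
      · simp [mul_comm]
  · rintro x ⟨hx, hfx⟩
    have hSPN : S = P ∪ N := by
      ext z
      simp only [hP, hN, Set.mem_union, Set.mem_sep_iff, ← and_or_left, le_or_gt, and_true]
    rw [SetLike.mem_coe, hSPN, Submodule.span_union] at hx
    obtain ⟨p, hp, n, hn, rfl⟩ := Submodule.mem_sup.1 hx
    have hfpn : 0 ≤ f p + f n := by simpa using hfx
    have hpG : p ∈ hull 𝕜 G := Submodule.span_mono Set.subset_union_left hp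
    rcases (nonneg_of_mem_hull (fun z hz => hz.2) hp).eq_or_lt with h_zero | h_pos
    · have : n = 0 := eq_zero_of_mem_hull (fun z hz => hz.2) hn (by simpa [← h_zero] using hfpn)
      simpa [this] using hpG
    · have h_mem : f p • n - f n • p ∈ hull 𝕜 G :=
        smul_sub_smul_mem_of_mem_hull (s := P) (t := N)
          (fun z hz w hw => subset_hull (Or.inr ⟨z, hz, w, hw, rfl⟩)) hp hn
      have h_eq : p + n = (f p)⁻¹ • ((f p + f n) • p + (f p • n - f n • p)) := by
        rw [eq_inv_smul_iff₀ h_pos.ne']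
        module
      change p + n ∈ hull 𝕜 G
      rw [h_eq]
      exact PointedCone.smul_mem _ (inv_nonneg.2 h_pos.le)
        (add_mem (PointedCone.smul_mem _ hfpn hpG) h_mem)

/-- A polyhedral cone in a finite-dimensional vector space is finitely generated. -/
theorem fg_iInf_comap_positive [FiniteDimensional 𝕜 E] {ι : Type*} (s : Finset ι)
    (f : ι → E →ₗ[𝕜] 𝕜) : (⨅ i ∈ s, (positive 𝕜 𝕜).comap (f i)).FG := by
  classical
  induction s using Finset.induction_on with
  | empty => simpa using fg_top
  | insert i s _ ih =>
    rw [Finset.iInf_insert, inf_comm]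
    exact fg_inf_comap_positive ih (f i)

theorem mem_hull_finset {S : Finset E} {x : E} :
    x ∈ hull 𝕜 (S : Set E) ↔ ∃ t : E → 𝕜, (∀ s, 0 ≤ t s) ∧ x = ∑ s ∈ S, t s • s := by
  constructor
  · intro hx
    obtain ⟨t, -, rfl⟩ := Submodule.mem_span_finset.1 hx
    exact ⟨fun s => t s, fun s => (t s).2, rfl⟩
  · rintro ⟨t, ht, rfl⟩
    exact sum_mem fun s hs => PointedCone.smul_mem _ (ht s) (subset_hull hs)

end Field

end PointedCone

/-- The preimage of the nonnegative orthant of `ℝᵐ` under an `ℝ`-linear map from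
a finite-dimensional real vector space is a finitely generated convex cone: it
is the set of nonnegative real linear combinations of a finite set. -/
theorem preimage_orthant_fg_cone (Z : Type*) [AddCommGroup Z] [Module ℝ Z]
    [FiniteDimensional ℝ Z] (m : ℕ) (φ : Z →ₗ[ℝ] (Fin m → ℝ)) :
    ∃ S : Finset Z,
      φ ⁻¹' {y : Fin m → ℝ | ∀ i, 0 ≤ y i} =
        {z : Z | ∃ t : Z → ℝ, (∀ s, 0 ≤ t s) ∧ z = ∑ s ∈ S, t s • s} := by
  obtain ⟨S, hS⟩ := PointedCone.fg_iInf_comap_positive Finset.univ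
    fun i => LinearMap.proj i ∘ₗ φ
  refine ⟨S, Set.ext fun z => ?_⟩
  rw [Set.mem_ofPred_eq, ← PointedCone.mem_hull_finset, PointedCone.hull, hS]
  simp
end

section
/- Let A be a finite set and X, Y ⊆ ℝⁿ compact positively convex subsets. Let c̃ : ℝⁿ →ₗ[ℝ] ℝ × (A → ℝⁿ) be a linear map, written c̃ x = (c̃_o x, fun a => c̃_a x), and suppose c̃_o x ≥ 0 for all x ∈ X. Then c̃ x ∈ Ĝ Y for all x ∈ X if and only if for every x ∈ ℝⁿ and every t > 0 with x ∈ t • X one has: for each a ∈ A there exists s ≥ 0 with c̃_a x ∈ s • Y, and c̃_o x + ∑_{a ∈ A} gauge Y (c̃_a x) ≤ t. -/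
open scoped Pointwise

/-- The subcubic convex functor `Ĝ` on a positively convex subset `X` of a real
vector space. -/
def Ghat (A : Type*) [Fintype A] {V : Type*} [AddCommGroup V] [Module ℝ V]
    (X : Set V) : Set (ℝ × (A → V)) :=
  {oφ | 0 ≤ oφ.1 ∧ oφ.1 ≤ 1 ∧
    ∃ (p : A → ℝ) (x : A → V),
      (∀ a, 0 ≤ p a ∧ p a ≤ 1 ∧ x a ∈ X ∧ oφ.2 a = p a • x a) ∧
      oφ.1 + ∑ a, p a ≤ 1}

/-- For a compact set `Y`, the infimum defining `gauge Y z` is attained as soon as `z` lies in some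
nonnegative multiple of `Y`. -/
theorem IsCompact.mem_gauge_smul {E : Type*} [AddCommGroup E] [Module ℝ E] [TopologicalSpace E]
    [T1Space E] [ContinuousSMul ℝ E] {Y : Set E} (hY : IsCompact Y) (hY0 : (0 : E) ∈ Y) {z : E}
    {s : ℝ} (hs : 0 ≤ s) (hz : z ∈ s • Y) : z ∈ gauge Y z • Y := by
  let T : Set (ℝ × E) := (Set.Icc 0 s ×ˢ Y) ∩ {q | q.1 • q.2 = z}
  have hT : IsCompact T := (isCompact_Icc.prod hY).inter_right
    (isClosed_singleton.preimage (continuous_fst.smul continuous_snd))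
  obtain ⟨y, hy, hyz⟩ := hz
  have hTne : (Prod.fst '' T).Nonempty := ⟨s, (s, y), ⟨⟨⟨hs, le_rfl⟩, hy⟩, hyz⟩, rfl⟩
  obtain ⟨m, ⟨⟨m', w⟩, ⟨⟨⟨hm0, hms⟩, hw⟩, hwz⟩, rfl⟩, hmin⟩ :=
    (hT.image continuous_fst).exists_isLeast hTne
  have hzm : z ∈ m' • Y := ⟨w, hw, hwz⟩
  have hle : m' ≤ gauge Y z := by
    refine le_csInf ?_ ?_
    · rcases hs.eq_or_lt with rfl | hs
      · exact ⟨1, one_pos, 0, hY0, by simpa using hyz⟩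
      · exact ⟨s, hs, y, hy, hyz⟩
    · rintro r ⟨hr, v, hv, hvz⟩
      rcases le_total r s with hrs | hrs
      · exact hmin ⟨(r, v), ⟨⟨⟨le_of_lt hr, hrs⟩, hv⟩, hvz⟩, rfl⟩
      · exact le_trans hms hrs
  rwa [(gauge_le_of_mem hm0 hzm).antisymm hle]

/-- Corollary 2 of the paper: a linear map `c̃` with nonnegative output on `X`
maps `X` into `Ĝ Y` iff a gauge inequality holds on all of `ℝⁿ`. -/
theorem map_into_Ghat_iff_gauge_ineq (A : Type*) [Fintype A] (n : ℕ)
    (X Y : Set (Fin n → ℝ))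
    (hX0 : (0 : Fin n → ℝ) ∈ X) (hXc : Convex ℝ X) (hXcpt : IsCompact X)
    (hY0 : (0 : Fin n → ℝ) ∈ Y) (hYc : Convex ℝ Y) (hYcpt : IsCompact Y)
    (ct : (Fin n → ℝ) →ₗ[ℝ] ℝ × (A → Fin n → ℝ))
    (hpos : ∀ x ∈ X, 0 ≤ (ct x).1) :
    (∀ x ∈ X, ct x ∈ Ghat A Y) ↔
      ∀ x : Fin n → ℝ, ∀ t : ℝ, 0 < t → x ∈ t • X →
        (∀ a, ∃ s : ℝ, 0 ≤ s ∧ (ct x).2 a ∈ s • Y) ∧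
        (ct x).1 + ∑ a, gauge Y ((ct x).2 a) ≤ t := by
  constructor
  · rintro h _ t ht ⟨x, hx, rfl⟩
    obtain ⟨-, -, p, y, hy, hsum⟩ := h x hx
    have hmem (a : A) : (ct (t • x)).2 a ∈ (t * p a) • Y :=
      ⟨y a, (hy a).2.2.1, by simp [(hy a).2.2.2, mul_smul]⟩
    have hnonneg (a : A) : 0 ≤ t * p a := mul_nonneg ht.le (hy a).1
    refine ⟨fun a => ⟨t * p a, hnonneg a, hmem a⟩, ?_⟩
    calc (ct (t • x)).1 + ∑ a, gauge Y ((ct (t • x)).2 a)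
        ≤ t * (ct x).1 + ∑ a, t * p a := by
          refine add_le_add (by simp) ?_
          exact Finset.sum_le_sum fun a _ => gauge_le_of_mem (hnonneg a) (hmem a)
      _ = t * ((ct x).1 + ∑ a, p a) := by rw [← Finset.mul_sum, mul_add]
      _ ≤ t := mul_le_of_le_one_right ht.le hsum
  · intro h x hx
    obtain ⟨hcone, hsum⟩ := h x 1 one_pos (by simpa using hx)
    have hg (a : A) : (ct x).2 a ∈ gauge Y ((ct x).2 a) • Y := by
      obtain ⟨s, hs, hmem⟩ := hcone a
      exact hYcpt.mem_gauge_smul hY0 hs hmem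
    choose y hy hyz using hg
    have hx0 := hpos x hx
    have hsum0 : 0 ≤ ∑ a, gauge Y ((ct x).2 a) := Finset.sum_nonneg fun a _ => gauge_nonneg _
    refine ⟨hx0, by linarith, fun a => gauge Y ((ct x).2 a), y,
      fun a => ⟨gauge_nonneg _, ?_, hy a, (hyz a).symm⟩, hsum⟩
    have := Finset.single_le_sum (f := fun a => gauge Y ((ct x).2 a))
      (fun a _ => gauge_nonneg _) (Finset.mem_univ a)
    linarith
end
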